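/- arXiv:1412.5831 — 2 statements merged into one kernel-verified Lean document; each statement's English description precedes it below -/
import Mathlib

section
/- Let L' > L ≥ 1 and K ≥ 3. Let p, p' ∈ 𝔓_>([L]) and let W_1,…,W_K, V_1,…,V_K ∈ 𝒲([L],[L']) all be injective as linear maps (rank L). If (W_1⊗…⊗W_K) p^{(K)} = (V_1⊗…⊗V_K) p'^{(K)}, then there exists a permutation τ of [L] such that p'(i) = p(τ(i)) for all i ∈ [L] and V_k δ_i = W_k δ_{τ(i)} for all k ∈ [K] and i ∈ [L]; that is, a dependent component system with at least three channels and L' > L is invertible up to a permutation on [L]. -/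
open scoped BigOperators

/-- `p` is a probability distribution on `Fin L`. -/
def probDist {L : ℕ} (p : Fin L → ℝ) : Prop :=
  (∀ i, 0 ≤ p i) ∧ ∑ i, p i = 1

/-- `p` is a probability distribution on `Fin L` with all entries strictly positive. -/
def probPos {L : ℕ} (p : Fin L → ℝ) : Prop :=
  (∀ i, 0 < p i) ∧ ∑ i, p i = 1

/-- `p^{(K)}`: the function on `[L]^K` equal to `p i` on the constant tuple `(i,…,i)`
and `0` elsewhere. -/
def diagEmbed {L : ℕ} (p : Fin L → ℝ) (K : ℕ) : (Fin K → Fin L) → ℝ :=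
  fun y => ∑ i, if (∀ k, y k = i) then p i else 0

/-- The action of `X_1 ⊗ … ⊗ X_K` on functions `[L]^K → ℝ`. -/
def tensorAct {L L' K : ℕ} (X : Fin K → Matrix (Fin L') (Fin L) ℝ)
    (v : (Fin K → Fin L) → ℝ) : (Fin K → Fin L') → ℝ :=
  fun y => ∑ x : Fin K → Fin L, v x * ∏ k, X k (y k) (x k)

/-- A channel from `[L]` to `[L']`: an `L' × L` column-stochastic matrix. -/
def isChannel {L L' : ℕ} (W : Matrix (Fin L') (Fin L) ℝ) : Prop :=
  (∀ i j, 0 ≤ W i j) ∧ ∀ j, ∑ i, W i j = 1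

theorem tensorAct_diagEmbed_apply {L L' K : ℕ}
    (X : Fin K → Matrix (Fin L') (Fin L) ℝ) (p : Fin L → ℝ) (y : Fin K → Fin L') :
    tensorAct X (diagEmbed p K) y = ∑ i, p i * ∏ k, X k (y k) i := by
  simp only [tensorAct, diagEmbed, Finset.sum_mul]
  rw [Finset.sum_comm]
  refine Finset.sum_congr rfl fun i _ => ?_
  rw [Finset.sum_eq_single (fun _ => i)]
  · simp
  · intro x _ hx
    rw [if_neg fun h => hx (funext h), zero_mul]
  · simp

/-- Contracting a diagonal tensor with one vector in each mode. -/
theorem sum_tensorAct_diagEmbed {L L' K : ℕ}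
    (X : Fin K → Matrix (Fin L') (Fin L) ℝ) (p : Fin L → ℝ) (f : Fin K → Fin L' → ℝ) :
    ∑ y, (∏ k, f k (y k)) * tensorAct X (diagEmbed p K) y
      = ∑ i, p i * ∏ k, Matrix.vecMul (f k) (X k) i := by
  simp only [tensorAct_diagEmbed_apply, Finset.mul_sum]
  rw [Finset.sum_comm]
  refine Finset.sum_congr rfl fun i _ => ?_
  simp only [Matrix.vecMul, dotProduct]
  rw [Finset.prod_univ_sum, Finset.mul_sum, Fintype.piFinset_univ]
  refine Finset.sum_congr rfl fun y _ => ?_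
  rw [Finset.prod_mul_distrib]
  ring

theorem isChannel.one_vecMul {L L' : ℕ} {W : Matrix (Fin L') (Fin L) ℝ} (hW : isChannel W)
    (i : Fin L) : Matrix.vecMul 1 W i = 1 := by
  simpa [Matrix.vecMul, dotProduct] using hW.2 i

/-- Contracting with the all-ones vector in every mode but three. -/
theorem sum_tensorAct_diagEmbed_three {L L' K : ℕ}
    {X : Fin K → Matrix (Fin L') (Fin L) ℝ} (hX : ∀ k, isChannel (X k)) (p : Fin L → ℝ)
    {a b c : Fin K} (hab : a ≠ b) (hac : a ≠ c) (hbc : b ≠ c) (φ ψ χ : Fin L' → ℝ) :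
    ∑ y, (∏ k, (if k = a then φ else if k = b then ψ else if k = c then χ else 1) (y k)) *
        tensorAct X (diagEmbed p K) y
      = ∑ i, p i * (Matrix.vecMul φ (X a) i * Matrix.vecMul ψ (X b) i *
          Matrix.vecMul χ (X c) i) := by
  rw [sum_tensorAct_diagEmbed X p
    fun k => if k = a then φ else if k = b then ψ else if k = c then χ else 1]
  refine Finset.sum_congr rfl fun i _ => ?_
  congr 1
  rw [← Finset.prod_subset (Finset.subset_univ {a, b, c})]
  · rw [Finset.prod_insert (by simp [hab, hac]), Finset.prod_insert (by simp [hbc]),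
      Finset.prod_singleton]
    simp [hab.symm, hac.symm, hbc.symm, mul_assoc]
  · intro k _ hk
    simp only [Finset.mem_insert, Finset.mem_singleton, not_or] at hk
    simp [hk.1, hk.2.1, hk.2.2, (hX k).one_vecMul]

theorem exists_mul_eq_one_of_mulVec_injective {L L' : ℕ} {W : Matrix (Fin L') (Fin L) ℝ}
    (hW : Function.Injective W.mulVec) : ∃ P : Matrix (Fin L) (Fin L') ℝ, P * W = 1 := by
  obtain ⟨g, hg⟩ := (Matrix.toLin' W).exists_leftInverse_of_injective
    (LinearMap.ker_eq_bot.2 hW)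
  refine ⟨LinearMap.toMatrix' g, ?_⟩
  have h := congrArg LinearMap.toMatrix' hg
  rwa [LinearMap.toMatrix'_comp, LinearMap.toMatrix'_toLin', LinearMap.toMatrix'_id] at h

/-- Proportional columns of channels agree. -/
theorem isChannel.col_eq_of_smul_eq {L L' : ℕ} {C C' : Matrix (Fin L') (Fin L) ℝ}
    (hC : isChannel C) (hC' : isChannel C') {i j : Fin L} {s t : ℝ} (hs : s ≠ 0)
    (h : ∀ a, s * C a i = t * C' a j) : s = t ∧ ∀ a, C a i = C' a j := by
  have hst : s = t := by
    have := Finset.sum_congr (rfl : (Finset.univ : Finset (Fin L')) = Finset.univ) fun a _ => h a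
    rwa [← Finset.mul_sum, ← Finset.mul_sum, hC.2, hC'.2, mul_one, mul_one] at this
  subst hst
  exact ⟨rfl, fun a => mul_left_cancel₀ hs (h a)⟩

theorem exists_perm_of_mul_eq_zero {n : ℕ} {M N : Matrix (Fin n) (Fin n) ℝ}
    (hoff : ∀ i l, i ≠ l → ∀ j, M i j * N l j = 0) (hdiag : ∀ i, ∃ j, M i j * N i j ≠ 0) :
    ∃ σ : Equiv.Perm (Fin n), ∀ i j, j ≠ σ i → M i j = 0 ∧ N i j = 0 := by
  choose s hs using hdiag
  have hz : ∀ i l, i ≠ l → M i (s l) = 0 ∧ N i (s l) = 0 := fun i l hil =>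
    ⟨(mul_eq_zero.1 (hoff i l hil (s l))).resolve_right (right_ne_zero_of_mul (hs l)),
      (mul_eq_zero.1 (hoff l i hil.symm (s l))).resolve_left (left_ne_zero_of_mul (hs l))⟩
  have hinj : Function.Injective s := by
    intro i l h
    by_contra hil
    apply hs i
    rw [h, (hz i l hil).1, zero_mul]
  refine ⟨Equiv.ofBijective s (Finite.injective_iff_bijective.1 hinj), fun i j hj => ?_⟩
  obtain ⟨l, rfl⟩ := (Finite.injective_iff_surjective.1 hinj) j
  refine hz i l ?_
  rintro rfl
  exact hj rfl

/-- Uniqueness of the decomposition of a three-mode tensor into linearly independent families. -/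
theorem exists_perm_of_three_mode_eq {L L' : ℕ} {p p' : Fin L → ℝ}
    (hp : ∀ i, 0 < p i) (hp' : ∀ i, 0 < p' i)
    {A B C A' B' C' : Matrix (Fin L') (Fin L) ℝ}
    (hA : isChannel A) (hB : isChannel B) (hC : isChannel C)
    (hA' : isChannel A') (hB' : isChannel B') (hC' : isChannel C')
    (iA : Function.Injective A.mulVec) (iB : Function.Injective B.mulVec)
    (iC' : Function.Injective C'.mulVec)
    (h : ∀ φ ψ χ : Fin L' → ℝ,
      ∑ i, p i * (Matrix.vecMul φ A i * Matrix.vecMul ψ B i * Matrix.vecMul χ C i)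
        = ∑ i, p' i * (Matrix.vecMul φ A' i * Matrix.vecMul ψ B' i * Matrix.vecMul χ C' i)) :
    ∃ σ : Equiv.Perm (Fin L), ∀ i, p i = p' (σ i) ∧ (∀ a, A a i = A' a (σ i)) ∧
      (∀ a, B a i = B' a (σ i)) ∧ ∀ a, C a i = C' a (σ i) := by
  obtain ⟨P, hP⟩ := exists_mul_eq_one_of_mulVec_injective iA
  obtain ⟨Q, hQ⟩ := exists_mul_eq_one_of_mulVec_injective iB
  have eP : ∀ i, Matrix.vecMul (P i) A = (1 : Matrix (Fin L) (Fin L) ℝ) i := fun i => by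
    rw [← hP]; rfl
  have eQ : ∀ i, Matrix.vecMul (Q i) B = (1 : Matrix (Fin L) (Fin L) ℝ) i := fun i => by
    rw [← hQ]; rfl
  have eM : ∀ i, Matrix.vecMul (P i) A' = (P * A') i := fun i => rfl
  have eN : ∀ i, Matrix.vecMul (Q i) B' = (Q * B') i := fun i => rfl
  generalize P * A' = M at eM
  generalize Q * B' = N at eN
  have hPQ : ∀ i l a, (if i = l then p i * C a i else 0)
      = ∑ j, p' j * (M i j * N l j * C' a j) := by
    intro i l a
    have := h (P i) (Q l) (Pi.single a 1)
    simp only [eP, eQ, eM, eN, Matrix.single_one_vecMul, Matrix.row_apply] at this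
    rw [← this]
    split_ifs with hil
    · subst hil
      simp [Matrix.one_apply]
    · symm
      refine Finset.sum_eq_zero fun j _ => ?_
      by_cases hij : i = j
      · subst hij; simp [Ne.symm hil]
      · simp [Matrix.one_apply, hij]
  have hMB : ∀ i a, p i * B a i = ∑ j, p' j * (M i j * B' a j) := by
    intro i a
    have := h (P i) (Pi.single a 1) 1
    simpa [eP, eM, hC.one_vecMul, hC'.one_vecMul, Matrix.one_apply] using this
  have hNA : ∀ i a, p i * A a i = ∑ j, p' j * (N i j * A' a j) := by
    intro i a
    have := h (Pi.single a 1) (Q i) 1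
    simpa [eQ, eN, hC.one_vecMul, hC'.one_vecMul, Matrix.one_apply, mul_comm] using this
  obtain ⟨σ, hσ⟩ := exists_perm_of_mul_eq_zero (M := M) (N := N)
    (by
      intro i l hil j
      have hz : C'.mulVec (fun j => p' j * (M i j * N l j)) = C'.mulVec 0 := by
        ext a
        have := hPQ i l a
        rw [if_neg hil] at this
        rw [Matrix.mulVec_zero, Pi.zero_apply, this]
        simp only [Matrix.mulVec, dotProduct]
        exact Finset.sum_congr rfl fun j _ => by ring
      exact (mul_eq_zero.1 (congrFun (iC' hz) j)).resolve_left (hp' j).ne')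
    (by
      intro i
      by_contra! hz
      have : ∑ a, p i * C a i = 0 := Finset.sum_eq_zero fun a _ => by
        have := hPQ i i a
        rw [if_pos rfl] at this
        simp [this, hz]
      rw [← Finset.mul_sum, hC.2, mul_one] at this
      exact (hp i).ne' this)
  refine ⟨σ, fun i => ?_⟩
  have hC₂ := hC.col_eq_of_smul_eq hC' (i := i) (j := σ i) (t := p' (σ i) * (M i (σ i) * N i (σ i)))
    (hp i).ne' fun a => by
      have := hPQ i i a
      rw [if_pos rfl] at this
      rw [this, Finset.sum_eq_single (σ i) (fun j _ hj => by simp [hσ i j hj]) (by simp)]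
      ring
  have hB₂ := hB.col_eq_of_smul_eq hB' (i := i) (j := σ i) (t := p' (σ i) * M i (σ i))
    (hp i).ne' fun a => by
      rw [hMB, Finset.sum_eq_single (σ i) (fun j _ hj => by simp [hσ i j hj]) (by simp)]
      ring
  have hA₂ := hA.col_eq_of_smul_eq hA' (i := i) (j := σ i) (t := p' (σ i) * N i (σ i))
    (hp i).ne' fun a => by
      rw [hNA, Finset.sum_eq_single (σ i) (fun j _ hj => by simp [hσ i j hj]) (by simp)]
      ring
  refine ⟨?_, hA₂.2, hB₂.2, hC₂.2⟩
  have hN : N i (σ i) = 1 := by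
    apply mul_left_cancel₀ (hp i).ne'
    rw [mul_one]
    conv_lhs => rw [hB₂.1]
    rw [hC₂.1]
    ring
  rw [hA₂.1, hN, mul_one]

theorem col_injective_of_mulVec_injective {L L' : ℕ} {W : Matrix (Fin L') (Fin L) ℝ}
    (hW : Function.Injective W.mulVec) {i j : Fin L} (h : ∀ a, W a i = W a j) : i = j := by
  have : (Pi.single i 1 : Fin L → ℝ) = Pi.single j 1 := hW (by ext a; simpa using h a)
  by_contra hij
  simpa [hij] using congrFun this i

theorem invertible_up_to_permutation_Lprime_gt_L (L L' K : ℕ)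
    (hL : 1 ≤ L) (hLL' : L < L') (hK : 3 ≤ K)
    (p p' : Fin L → ℝ) (hp : probPos p) (hp' : probPos p')
    (W V : Fin K → Matrix (Fin L') (Fin L) ℝ)
    (hW : ∀ k, isChannel (W k) ∧ Function.Injective (W k).mulVec)
    (hV : ∀ k, isChannel (V k) ∧ Function.Injective (V k).mulVec)
    (heq : tensorAct W (diagEmbed p K) = tensorAct V (diagEmbed p' K)) :
    ∃ τ : Equiv.Perm (Fin L),
      (∀ i, p' i = p (τ i)) ∧ ∀ (k : Fin K) (a : Fin L') (i : Fin L),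
        V k a i = W k a (τ i) := by
  have main : ∀ a b c : Fin K, a ≠ b → a ≠ c → b ≠ c → ∃ σ : Equiv.Perm (Fin L), ∀ i,
      p i = p' (σ i) ∧ (∀ x, W a x i = V a x (σ i)) ∧
      (∀ x, W b x i = V b x (σ i)) ∧ ∀ x, W c x i = V c x (σ i) := by
    intro a b c hab hac hbc
    refine exists_perm_of_three_mode_eq hp.1 hp'.1 (hW a).1 (hW b).1 (hW c).1
      (hV a).1 (hV b).1 (hV c).1 (hW a).2 (hW b).2 (hV c).2 fun φ ψ χ => ?_
    rw [← sum_tensorAct_diagEmbed_three (fun k => (hW k).1) p hab hac hbc, heq,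
      sum_tensorAct_diagEmbed_three (fun k => (hV k).1) p' hab hac hbc]
  obtain ⟨a, b, c, hab, hac, hbc⟩ : ∃ a b c : Fin K, a ≠ b ∧ a ≠ c ∧ b ≠ c :=
    ⟨⟨0, by omega⟩, ⟨1, by omega⟩, ⟨2, by omega⟩, by simp, by simp, by simp⟩
  obtain ⟨σ, hσ⟩ := main a b c hab hac hbc
  have hall : ∀ k x i, W k x i = V k x (σ i) := by
    intro k x i
    by_cases hka : a = k
    · subst hka; exact (hσ i).2.1 x
    by_cases hkb : b = k
    · subst hkb; exact (hσ i).2.2.1 x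
    obtain ⟨ρ, hρ⟩ := main a b k hab hka hkb
    have : ρ i = σ i := col_injective_of_mulVec_injective (hV a).2 fun y => by
      rw [← (hρ i).2.1, ← (hσ i).2.1]
    rw [← this]
    exact (hρ i).2.2.2 x
  refine ⟨σ.symm, fun i => ?_, fun k x i => ?_⟩
  · rw [(hσ _).1, Equiv.apply_symm_apply]
  · rw [hall, Equiv.apply_symm_apply]
end

section
/- Let W ∈ 𝒲([L],[L']) be a channel satisfying W δ_i ≠ W δ_j for all i ≠ j in [L], and let K ≥ L − 1. Then the family of K-fold tensor powers {(W δ_i)^{⊗K}}_{i=1}^L is linearly independent in the space of functions [L']^K → ℝ; consequently the map p ↦ W^{⊗K} p^{(K)} is injective on 𝔓([L]), i.e., W^{⊗K} is invertible as a map from 𝔓^{(K)}([L]) to distributions on [L']^K. -/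
open scoped BigOperators

/-- If `L - 1 ≤ K`, some `s : Fin K → Fin L` hits every element other than a given `j`. -/
theorem exists_map_hitting_ne {L K : ℕ} (hK : L - 1 ≤ K) (j : Fin L) :
    ∃ s : Fin K → Fin L, ∀ i, i ≠ j → ∃ k, s k = i := by
  obtain _ | n := L
  · exact j.elim0
  refine ⟨fun k => if h : k.val < n then j.succAbove ⟨k, h⟩ else j, fun i hij => ?_⟩
  obtain ⟨m, rfl⟩ := Fin.exists_succAbove_eq hij
  exact ⟨⟨m, by omega⟩, by simp⟩

/-- Distinct columns of a matrix with unit column sums are separated by linear functionals. -/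
theorem exists_functional_separating_columns {L L' : ℕ} {W : Matrix (Fin L') (Fin L) ℝ}
    (hsum : ∀ j, ∑ a, W a j = 1) {i j : Fin L} (hij : (fun a => W a i) ≠ fun a => W a j) :
    ∃ g : Fin L' → ℝ, ∑ a, g a * W a i = 0 ∧ ∑ a, g a * W a j ≠ 0 := by
  obtain ⟨b, hb⟩ := Function.ne_iff.mp hij
  have key (l : Fin L) : ∑ a, ((if a = b then 1 else 0) - W b i) * W a l = W b l - W b i := by
    simp [sub_mul, Finset.sum_sub_distrib, ← Finset.mul_sum, hsum]
  refine ⟨fun a => (if a = b then 1 else 0) - W b i, ?_, ?_⟩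
  · rw [key, sub_self]
  · rw [key]
    exact sub_ne_zero.mpr (Ne.symm hb)

/-- A linear relation between tensor powers of columns may be tested on product functionals. -/
theorem sum_mul_prod_functional_eq_zero {L L' K : ℕ} {W : Matrix (Fin L') (Fin L) ℝ}
    {c : Fin L → ℝ} (hc : ∀ y : Fin K → Fin L', ∑ i, c i * ∏ k, W (y k) i = 0)
    (g : Fin K → Fin L' → ℝ) :
    ∑ i, c i * ∏ k, ∑ a, g k a * W a i = 0 := by
  simp_rw [Fintype.prod_sum, Finset.prod_mul_distrib, Finset.mul_sum]
  rw [Finset.sum_comm]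
  refine Finset.sum_eq_zero fun y _ => ?_
  simp_rw [mul_left_comm (c _)]
  rw [← Finset.mul_sum, hc, mul_zero]

/-- The `K`-fold tensor powers of `L ≤ K + 1` distinct vectors with unit sums are linearly
independent. -/
theorem linearIndependent_tensorPower_columns {L L' K : ℕ} (hK : L - 1 ≤ K)
    {W : Matrix (Fin L') (Fin L) ℝ} (hsum : ∀ j, ∑ a, W a j = 1)
    (hcols : ∀ i j : Fin L, i ≠ j → (fun a => W a i) ≠ (fun a => W a j)) :
    LinearIndependent ℝ (fun i : Fin L => fun y : Fin K → Fin L' => ∏ k, W (y k) i) := by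
  rw [Fintype.linearIndependent_iff]
  intro c hc j
  have hc' (y : Fin K → Fin L') : ∑ i, c i * ∏ k, W (y k) i = 0 := by
    simpa using congrFun hc y
  obtain ⟨s, hs⟩ := exists_map_hitting_ne hK j
  have hg (i : Fin L) : ∃ g : Fin L' → ℝ,
      (i ≠ j → ∑ a, g a * W a i = 0) ∧ ∑ a, g a * W a j ≠ 0 := by
    by_cases hij : i = j
    · exact ⟨1, fun h => absurd hij h, by simp [hsum]⟩
    · obtain ⟨g, hgi, hgj⟩ := exists_functional_separating_columns hsum (hcols i j hij)
      exact ⟨g, fun _ => hgi, hgj⟩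
  choose g hgi hgj using hg
  have h := sum_mul_prod_functional_eq_zero hc' (fun k => g (s k))
  rw [Finset.sum_eq_single j] at h
  · exact (mul_eq_zero.mp h).resolve_right (Finset.prod_ne_zero_iff.mpr fun k _ => hgj (s k))
  · intro i _ hij
    obtain ⟨k, hk⟩ := hs i hij
    rw [Finset.prod_eq_zero (Finset.mem_univ k) (by rw [hk]; exact hgi i hij), mul_zero]
  · simp

theorem tensorAct_diagEmbed {L L' K : ℕ} (W : Matrix (Fin L') (Fin L) ℝ) (p : Fin L → ℝ) :
    tensorAct (fun _ : Fin K => W) (diagEmbed p K)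
      = ∑ i, p i • fun y : Fin K → Fin L' => ∏ k, W (y k) i := by
  funext y
  have hconst (x : Fin K → Fin L) (i : Fin L) : (∀ k, x k = i) ↔ x = fun _ => i :=
    funext_iff.symm
  simp only [tensorAct, diagEmbed, Finset.sum_mul, Finset.sum_apply, Pi.smul_apply, smul_eq_mul,
    hconst]
  rw [Finset.sum_comm]
  simp [ite_mul]

theorem inversification (L L' K : ℕ) (hL : 1 ≤ L) (hL' : 1 ≤ L')
    (hK : L - 1 ≤ K) (W : Matrix (Fin L') (Fin L) ℝ) (hW : isChannel W)
    (hcols : ∀ i j : Fin L, i ≠ j → (fun a => W a i) ≠ (fun a => W a j)) :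
    LinearIndependent ℝ
      (fun i : Fin L => fun y : Fin K → Fin L' => ∏ k, W (y k) i)
    ∧
    (∀ p p' : Fin L → ℝ, probDist p → probDist p' →
      tensorAct (fun _ : Fin K => W) (diagEmbed p K)
        = tensorAct (fun _ : Fin K => W) (diagEmbed p' K) →
      p = p') := by
  have hli := linearIndependent_tensorPower_columns hK hW.2 hcols
  refine ⟨hli, fun p p' _ _ h => ?_⟩
  rw [tensorAct_diagEmbed, tensorAct_diagEmbed] at h
  exact funext (Fintype.linearIndependent_iffₛ.mp hli p p' h)
end
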